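/- arXiv:2308.12395 — 3 statements merged into one kernel-verified Lean document; each statement's English description precedes it below -/
import Mathlib

section
/- Let H be a complete real inner product space, C ⊆ H a nonempty closed convex set, f : H → ℝ a convex function differentiable at a point x ∈ H with ‖∇f(x)‖ ≤ G, let η > 0, and let v ∈ C. Define x' = x − η·∇f(x) and let x̄ be the metric projection of x' onto C. Then f(x) − f(v) ≤ (1/(2η))·( ‖x − v‖² − ‖x̄ − v‖² ) + (η/2)·G². -/
/-- `p` is the metric projection of `z` onto the set `C`: `p ∈ C` and `p`
minimizes the distance to `z` over `C`. -/
def IsMetricProj {H : Type*} [NormedAddCommGroup H] (C : Set H) (z p : H) : Prop :=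
  p ∈ C ∧ ∀ y ∈ C, ‖z - p‖ ≤ ‖z - y‖

/-- The first-order condition for convexity: a convex function lies above its tangent at any
point of differentiability. -/
theorem ConvexOn.add_inner_gradient_le {H : Type*}
    [NormedAddCommGroup H] [InnerProductSpace ℝ H] [CompleteSpace H]
    {f : H → ℝ} (hf : ConvexOn ℝ Set.univ f) {x : H} (hdiff : DifferentiableAt ℝ f x) (v : H) :
    f x + inner ℝ (gradient f x) (v - x) ≤ f v := by
  have hline : ConvexOn ℝ Set.univ (f ∘ AffineMap.lineMap (k := ℝ) x v) :=
    hf.comp_affineMap (AffineMap.lineMap x v)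
  have hderiv : HasDerivAt (f ∘ AffineMap.lineMap (k := ℝ) x v)
      (inner ℝ (gradient f x) (v - x)) 0 := by
    have hx : HasFDerivAt f (InnerProductSpace.toDual ℝ H (gradient f x))
        (AffineMap.lineMap (k := ℝ) x v 0) := by
      simpa using hdiff.hasGradientAt.hasFDerivAt
    simpa using hx.comp_hasDerivAt 0 AffineMap.hasDerivAt_lineMap
  have hslope := hline.le_slope_of_hasDerivAt (Set.mem_univ 0) (Set.mem_univ 1) one_pos hderiv
  simp only [slope_def_field, Function.comp_apply, AffineMap.lineMap_apply_one,
    AffineMap.lineMap_apply_zero, sub_zero, div_one] at hslope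
  linarith

/-- The metric projection onto a convex set does not increase the distance to points of the
set. -/
theorem IsMetricProj.norm_sub_le {H : Type*} [NormedAddCommGroup H] [InnerProductSpace ℝ H]
    {C : Set H} (hC : Convex ℝ C) {z p v : H} (hp : IsMetricProj C z p) (hv : v ∈ C) :
    ‖p - v‖ ≤ ‖z - v‖ := by
  have : Nonempty C := ⟨⟨p, hp.1⟩⟩
  have hmin : ‖z - p‖ = ⨅ w : C, ‖z - w‖ :=
    le_antisymm (le_ciInf fun w => hp.2 w w.2)
      (ciInf_le ⟨0, Set.forall_mem_range.2 fun _ => norm_nonneg _⟩ (⟨p, hp.1⟩ : C))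
  have hinner := (norm_eq_iInf_iff_real_inner_le_zero hC hp.1).1 hmin v hv
  have hexpand := norm_sub_sq_real (z - p) (v - p)
  rw [sub_sub_sub_cancel_right, norm_sub_rev v p] at hexpand
  refine (sq_le_sq₀ (norm_nonneg _) (norm_nonneg _)).1 ?_
  linarith [sq_nonneg ‖z - p‖]

/-- **Per-step inequality of projected online gradient descent.**
Let `H` be a complete real inner product space, `C ⊆ H` nonempty closed convex,
`f : H → ℝ` convex and differentiable at `x` with `‖∇f(x)‖ ≤ G`, `η > 0`,
`v ∈ C`. If `x̄` is the metric projection of `x' = x − η∇f(x)` onto `C`, then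
`f(x) − f(v) ≤ (1/(2η))(‖x − v‖² − ‖x̄ − v‖²) + (η/2)G²`. -/
theorem ogd_step_inequality {H : Type*}
    [NormedAddCommGroup H] [InnerProductSpace ℝ H] [CompleteSpace H]
    (C : Set H) (hCne : C.Nonempty) (hCcl : IsClosed C) (hCcv : Convex ℝ C)
    (f : H → ℝ) (hf : ConvexOn ℝ Set.univ f)
    (x : H) (hdiff : DifferentiableAt ℝ f x)
    (G : ℝ) (hG : ‖gradient f x‖ ≤ G)
    (η : ℝ) (hη : 0 < η) (v : H) (hv : v ∈ C)
    (xbar : H) (hbar : IsMetricProj C (x - η • gradient f x) xbar) :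
    f x - f v ≤ (1 / (2 * η)) * (‖x - v‖ ^ 2 - ‖xbar - v‖ ^ 2) + (η / 2) * G ^ 2 := by
  have hfirst := hf.add_inner_gradient_le hdiff v
  rw [← neg_sub x v, inner_neg_right] at hfirst
  have hproj : ‖xbar - v‖ ^ 2 ≤ ‖x - η • gradient f x - v‖ ^ 2 := by
    gcongr
    exact hbar.norm_sub_le hCcv hv
  rw [sub_right_comm, norm_sub_sq_real (x - v), inner_smul_right, norm_smul, mul_pow,
    Real.norm_eq_abs, sq_abs, real_inner_comm (gradient f x)] at hproj
  have hsq : η ^ 2 * ‖gradient f x‖ ^ 2 ≤ η ^ 2 * G ^ 2 := by gcongr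
  have hscaled : 2 * η * (f x - f v) ≤ 2 * η * inner ℝ (gradient f x) (x - v) := by
    gcongr
    linarith
  calc f x - f v = (1 / (2 * η)) * (2 * η * (f x - f v)) := by field_simp
    _ ≤ (1 / (2 * η)) * (‖x - v‖ ^ 2 - ‖xbar - v‖ ^ 2 + η ^ 2 * G ^ 2) := by
      gcongr
      linarith
    _ = (1 / (2 * η)) * (‖x - v‖ ^ 2 - ‖xbar - v‖ ^ 2) + (η / 2) * G ^ 2 := by
      field_simp
end

section
/- Let H be a complete real inner product space, let C and C' be nonempty closed convex subsets of H, let f : H → ℝ be convex and differentiable at x ∈ H with ‖∇f(x)‖ ≤ G, let η > 0 and D ≥ 0, and let v ∈ C. Define x' = x − η·∇f(x), let x̄ be the metric projection of x' onto C, let x₊ be the metric projection of x' onto C', and set ζ = ‖x̄ − x₊‖. If ‖x₊ − v‖ ≤ D, then f(x) − f(v) ≤ (1/(2η))·( ‖x − v‖² − ‖x₊ − v‖² ) + (D·ζ)/η + (η/2)·G². -/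
/-- First-order condition: a convex function lies above its tangent hyperplanes. -/
theorem ConvexOn.inner_gradient_le_sub {H : Type*}
    [NormedAddCommGroup H] [InnerProductSpace ℝ H] [CompleteSpace H]
    {f : H → ℝ} (hf : ConvexOn ℝ Set.univ f) {x : H} (hdiff : DifferentiableAt ℝ f x) (y : H) :
    inner ℝ (gradient f x) (y - x) ≤ f y - f x := by
  have hconv : ConvexOn ℝ Set.univ (f ∘ AffineMap.lineMap (k := ℝ) x y) := by
    simpa using hf.comp_affineMap (AffineMap.lineMap (k := ℝ) x y)
  have hderiv : HasDerivAt (f ∘ AffineMap.lineMap (k := ℝ) x y) (fderiv ℝ f x (y - x)) 0 :=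
    HasFDerivAt.comp_hasDerivAt (0 : ℝ) (by simpa using hdiff.hasFDerivAt)
      AffineMap.hasDerivAt_lineMap
  have h := hconv.le_slope_of_hasDerivAt (Set.mem_univ 0) (Set.mem_univ 1) one_pos hderiv
  simpa [slope_def_field, inner_gradient_left] using h

theorem IsMetricProj.inner_sub_le_zero {H : Type*}
    [NormedAddCommGroup H] [InnerProductSpace ℝ H] {C : Set H} (hC : Convex ℝ C) {z p v : H}
    (hp : IsMetricProj C z p) (hv : v ∈ C) : inner ℝ (z - p) (v - p) ≤ 0 := by
  have : Nonempty C := ⟨⟨p, hp.1⟩⟩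
  refine (norm_eq_iInf_iff_real_inner_le_zero hC hp.1).1 (le_antisymm ?_ ?_) v hv
  · exact le_ciInf fun w => hp.2 w w.2
  · exact ciInf_le ⟨0, Set.forall_mem_range.2 fun _ => norm_nonneg _⟩ (⟨p, hp.1⟩ : C)

/-- The metric projection onto a convex set does not increase the distance to its points. -/
theorem IsMetricProj.norm_sub_sq_le {H : Type*}
    [NormedAddCommGroup H] [InnerProductSpace ℝ H] {C : Set H} (hC : Convex ℝ C) {z p v : H}
    (hp : IsMetricProj C z p) (hv : v ∈ C) : ‖p - v‖ ^ 2 ≤ ‖z - v‖ ^ 2 := by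
  have h := hp.inner_sub_le_zero hC hv
  have hexp := norm_sub_sq_real (z - p) (v - p)
  rw [sub_sub_sub_cancel_right, norm_sub_rev v p] at hexp
  nlinarith [sq_nonneg ‖z - p‖]

/-- **Per-step inequality of projected online gradient descent with a
time-varying domain.**
Let `H` be a complete real inner product space, `C, C' ⊆ H` nonempty closed
convex, `f : H → ℝ` convex and differentiable at `x` with `‖∇f(x)‖ ≤ G`,
`η > 0`, `D ≥ 0`, `v ∈ C`. With `x' = x − η∇f(x)`, `x̄ = Π_C(x')`,
`x₊ = Π_{C'}(x')`, and `ζ = ‖x̄ − x₊‖`, if `‖x₊ − v‖ ≤ D`, then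
`f(x) − f(v) ≤ (1/(2η))(‖x − v‖² − ‖x₊ − v‖²) + Dζ/η + (η/2)G²`. -/
theorem ogd_step_inequality_time_varying {H : Type*}
    [NormedAddCommGroup H] [InnerProductSpace ℝ H] [CompleteSpace H]
    (C C' : Set H) (hCne : C.Nonempty) (hCcl : IsClosed C) (hCcv : Convex ℝ C)
    (hC'ne : C'.Nonempty) (hC'cl : IsClosed C') (hC'cv : Convex ℝ C')
    (f : H → ℝ) (hf : ConvexOn ℝ Set.univ f)
    (x : H) (hdiff : DifferentiableAt ℝ f x)
    (G : ℝ) (hG : ‖gradient f x‖ ≤ G)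
    (η D : ℝ) (hη : 0 < η) (hD : 0 ≤ D) (v : H) (hv : v ∈ C)
    (xbar xplus : H)
    (hbar : IsMetricProj C (x - η • gradient f x) xbar)
    (hplus : IsMetricProj C' (x - η • gradient f x) xplus)
    (hDv : ‖xplus - v‖ ≤ D) :
    f x - f v ≤ (1 / (2 * η)) * (‖x - v‖ ^ 2 - ‖xplus - v‖ ^ 2)
      + D * ‖xbar - xplus‖ / η + (η / 2) * G ^ 2 := by
  have hconvex := hf.inner_gradient_le_sub hdiff v
  have hproj := hbar.norm_sub_sq_le hCcv hv
  have hstep : ‖x - η • gradient f x - v‖ ^ 2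
      = ‖x - v‖ ^ 2 + 2 * η * inner ℝ (gradient f x) (v - x) + η ^ 2 * ‖gradient f x‖ ^ 2 := by
    rw [sub_right_comm, norm_sub_sq_real, real_inner_smul_right, real_inner_comm, norm_smul,
      mul_pow, Real.norm_eq_abs, sq_abs, ← neg_sub x v, inner_neg_right]
    ring
  have hcauchy : -(D * ‖xbar - xplus‖) ≤ inner ℝ (xplus - v) (xbar - xplus) :=
    (neg_le_neg (mul_le_mul_of_nonneg_right hDv (norm_nonneg _))).trans
      (neg_le_of_abs_le (abs_real_inner_le_norm _ _))
  have hdrift : ‖xplus - v‖ ^ 2 - 2 * (D * ‖xbar - xplus‖) ≤ ‖xbar - v‖ ^ 2 := by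
    have hexp := norm_add_sq_real (xplus - v) (xbar - xplus)
    rw [add_comm (xplus - v), sub_add_sub_cancel] at hexp
    nlinarith [sq_nonneg ‖xbar - xplus‖]
  have hgrad : η ^ 2 * ‖gradient f x‖ ^ 2 ≤ η ^ 2 * G ^ 2 := by gcongr
  have hmul := mul_le_mul_of_nonneg_left hconvex (by positivity : 0 ≤ 2 * η)
  have hrhs : (1 / (2 * η)) * (‖x - v‖ ^ 2 - ‖xplus - v‖ ^ 2)
      + D * ‖xbar - xplus‖ / η + (η / 2) * G ^ 2
      = (‖x - v‖ ^ 2 - ‖xplus - v‖ ^ 2 + 2 * (D * ‖xbar - xplus‖) + η ^ 2 * G ^ 2)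
        / (2 * η) := by
    field_simp
  rw [hrhs, le_div_iff₀ (by positivity)]
  linarith
end

section
/- Under the setting of Safe Online Gradient Descent — a complete real inner product space H, a set X ⊆ H with 0 ∈ X and diameter at most D, nonempty closed convex subsets X_t ⊆ X for t = 1,…,T+1, convex differentiable losses f_t with ‖∇f_t(y)‖ ≤ G on X, step size η > 0, and iterates x_1 ∈ X_1, x'_{t+1} = x_t − η·∇f_t(x_t), x_{t+1} = Π_{X_{t+1}}(x'_{t+1}) — assume additionally that the domain sets are time-invariant, i.e., X_1 = X_2 = ⋯ = X_{T+1}. Then ζ_t = ‖Π_{X_t}(x'_{t+1}) − Π_{X_{t+1}}(x'_{t+1})‖ = 0 for all t, and for every comparator sequence v_t ∈ X_t with path length C_T = Σ_{t=2}^{T} ‖v_{t−1} − v_t‖, it holds that Σ_{t=1}^{T} f_t(x_t) − Σ_{t=1}^{T} f_t(v_t) ≤ (η·T·G²)/2 + (7·D²)/(4η) + (D·C_T)/η. -/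
/-- First-order condition for convexity: a convex function lies above its tangent hyperplane at
any point of differentiability. -/
theorem ConvexOn.sub_le_inner_gradient {H : Type*} [NormedAddCommGroup H] [InnerProductSpace ℝ H]
    [CompleteSpace H] {f : H → ℝ} (hf : ConvexOn ℝ Set.univ f) {x : H}
    (hd : DifferentiableAt ℝ f x) (y : H) :
    f x - f y ≤ inner ℝ (gradient f x) (x - y) := by
  have hline : HasDerivAt (fun s : ℝ => f (AffineMap.lineMap x y s))
      (inner ℝ (gradient f x) (y - x)) 0 := by
    have hx : HasFDerivAt f (InnerProductSpace.toDual ℝ H (gradient f x))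
        (AffineMap.lineMap x y (0 : ℝ)) := by
      simpa using hd.hasGradientAt.hasFDerivAt
    exact hx.comp_hasDerivAt 0 AffineMap.hasDerivAt_lineMap
  have hconv : ConvexOn ℝ Set.univ (fun s : ℝ => f (AffineMap.lineMap x y s)) :=
    hf.comp_affineMap (AffineMap.lineMap x y)
  have hslope := hconv.le_slope_of_hasDerivAt (Set.mem_univ 0) (Set.mem_univ 1) one_pos hline
  simp only [slope_def_field, AffineMap.lineMap_apply_one, AffineMap.lineMap_apply_zero, sub_zero,
    div_one] at hslope
  rw [← neg_sub y x, inner_neg_right]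
  linarith

namespace IsMetricProj

variable {H : Type*} [NormedAddCommGroup H] [InnerProductSpace ℝ H] {C : Set H} {z p q v : H}

theorem inner_le_zero (hC : Convex ℝ C) (hp : IsMetricProj C z p) (hv : v ∈ C) :
    inner ℝ (z - p) (v - p) ≤ 0 := by
  refine (norm_eq_iInf_iff_real_inner_le_zero hC hp.1).1 (le_antisymm ?_ ?_) v hv
  · have : Nonempty C := ⟨⟨p, hp.1⟩⟩
    exact le_ciInf fun w => hp.2 w w.2
  · exact ciInf_le ⟨0, Set.forall_mem_range.2 fun w : C => norm_nonneg (z - w)⟩ ⟨p, hp.1⟩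

theorem norm_sub_sq_add_le (hC : Convex ℝ C) (hp : IsMetricProj C z p) (hv : v ∈ C) :
    ‖z - p‖ ^ 2 + ‖p - v‖ ^ 2 ≤ ‖z - v‖ ^ 2 := by
  have h := inner_le_zero hC hp hv
  have e : ‖z - v‖ ^ 2 = ‖(z - p) - (v - p)‖ ^ 2 := by rw [sub_sub_sub_cancel_right]
  rw [e, norm_sub_sq_real (z - p), norm_sub_rev p v]
  linarith

theorem unique (hC : Convex ℝ C) (hp : IsMetricProj C z p) (hq : IsMetricProj C z q) :
    p = q := by
  have h₁ := norm_sub_sq_add_le hC hp hq.1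
  have h₂ := pow_le_pow_left₀ (norm_nonneg _) (hq.2 p hp.1) 2
  have h₃ : ‖p - q‖ ^ 2 = 0 := le_antisymm (by linarith) (sq_nonneg _)
  exact sub_eq_zero.1 (norm_eq_zero.1 (pow_eq_zero_iff two_ne_zero |>.1 h₃))

end IsMetricProj

/-- One step of projected gradient descent: the loss of the current iterate relative to a
comparator is controlled by the decrease in squared distance to that comparator. -/
theorem projected_gradient_step {H : Type*} [NormedAddCommGroup H] [InnerProductSpace ℝ H]
    [CompleteSpace H] {C : Set H} (hC : Convex ℝ C) {f : H → ℝ} (hf : ConvexOn ℝ Set.univ f)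
    {x x' v : H} (hd : DifferentiableAt ℝ f x) {η G : ℝ} (hη : 0 < η)
    (hG : ‖gradient f x‖ ≤ G) (hp : IsMetricProj C (x - η • gradient f x) x') (hv : v ∈ C) :
    f x - f v ≤ η * G ^ 2 / 2 + (‖x - v‖ ^ 2 - ‖x' - v‖ ^ 2) / (2 * η) := by
  have h₁ := hf.sub_le_inner_gradient hd v
  have h₂ := hp.norm_sub_sq_add_le hC hv
  have h₃ : ‖gradient f x‖ ^ 2 ≤ G ^ 2 := pow_le_pow_left₀ (norm_nonneg _) hG 2
  have h₄ : ‖x - η • gradient f x - v‖ ^ 2 = ‖x - v‖ ^ 2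
      - 2 * η * inner ℝ (gradient f x) (x - v) + η ^ 2 * ‖gradient f x‖ ^ 2 := by
    rw [sub_right_comm, norm_sub_sq_real, real_inner_smul_right, norm_smul, mul_pow,
      Real.norm_eq_abs, sq_abs, real_inner_comm]
    ring
  have h₅ : f x - f v - η * G ^ 2 / 2 ≤ (‖x - v‖ ^ 2 - ‖x' - v‖ ^ 2) / (2 * η) := by
    rw [le_div_iff₀ (by positivity)]
    nlinarith [mul_le_mul_of_nonneg_left h₁ hη.le, mul_le_mul_of_nonneg_left h₃ (sq_nonneg η),
      sq_nonneg ‖x - η • gradient f x - x'‖]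
  linarith

theorem norm_sub_sq_sub_norm_sub_sq_le {E : Type*} [SeminormedAddCommGroup E] {D : ℝ} {x v w : E}
    (hv : ‖x - v‖ ≤ D) (hw : ‖x - w‖ ≤ D) :
    ‖x - w‖ ^ 2 - ‖x - v‖ ^ 2 ≤ 2 * D * ‖v - w‖ := by
  have h : ‖x - w‖ - ‖x - v‖ ≤ ‖v - w‖ := by
    linarith [norm_sub_le_norm_sub_add_norm_sub x v w]
  nlinarith [norm_nonneg (x - w), norm_nonneg (x - v), norm_nonneg (v - w)]

/-- **Safe Online Gradient Descent with time-invariant domains.**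
Under the Safe-OGD setting, if additionally `X_1 = X_2 = ⋯ = X_{T+1}`, then
`ζ_t = ‖Π_{X_t}(x'_{t+1}) − Π_{X_{t+1}}(x'_{t+1})‖ = 0` for all `t`, and for
every comparator sequence `v_t ∈ X_t` with path length
`C_T = Σ_{t=2}^T ‖v_{t−1} − v_t‖`,
`Σ f_t(x_t) − Σ f_t(v_t) ≤ ηTG²/2 + 7D²/(4η) + D·C_T/η`. -/
theorem safe_ogd_time_invariant_regret {H : Type*}
    [NormedAddCommGroup H] [InnerProductSpace ℝ H] [CompleteSpace H]
    (T : ℕ) (D G η : ℝ) (hη : 0 < η)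
    (Xbig : Set H) (h0 : (0 : H) ∈ Xbig)
    (hdiam : ∀ y ∈ Xbig, ∀ z ∈ Xbig, ‖y - z‖ ≤ D)
    (X : ℕ → Set H)
    (hXsub : ∀ t, 1 ≤ t → t ≤ T + 1 → X t ⊆ Xbig)
    (hXne : ∀ t, 1 ≤ t → t ≤ T + 1 → (X t).Nonempty)
    (hXcl : ∀ t, 1 ≤ t → t ≤ T + 1 → IsClosed (X t))
    (hXcv : ∀ t, 1 ≤ t → t ≤ T + 1 → Convex ℝ (X t))
    (hXinv : ∀ t, 1 ≤ t → t ≤ T → X (t + 1) = X t)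
    (f : ℕ → H → ℝ)
    (hfcv : ∀ t, 1 ≤ t → t ≤ T → ConvexOn ℝ Set.univ (f t))
    (hfd : ∀ t, 1 ≤ t → t ≤ T → Differentiable ℝ (f t))
    (hfg : ∀ t, 1 ≤ t → t ≤ T → ∀ y ∈ Xbig, ‖gradient (f t) y‖ ≤ G)
    (x xbar : ℕ → H)
    (hx1 : x 1 ∈ X 1)
    (hproj : ∀ t, 1 ≤ t → t ≤ T →
      IsMetricProj (X (t + 1)) (x t - η • gradient (f t) (x t)) (x (t + 1)))
    (hbar : ∀ t, 1 ≤ t → t ≤ T →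
      IsMetricProj (X t) (x t - η • gradient (f t) (x t)) (xbar (t + 1)))
    (v : ℕ → H) (hv : ∀ t, 1 ≤ t → t ≤ T → v t ∈ X t) :
    (∀ t, 1 ≤ t → t ≤ T → ‖xbar (t + 1) - x (t + 1)‖ = 0) ∧
    ∑ t ∈ Finset.Icc 1 T, f t (x t) - ∑ t ∈ Finset.Icc 1 T, f t (v t)
      ≤ η * T * G ^ 2 / 2 + 7 * D ^ 2 / (4 * η)
        + D * (∑ t ∈ Finset.Icc 2 T, ‖v (t - 1) - v t‖) / η := by
  have hX : ∀ t, 1 ≤ t → t ≤ T + 1 → X t = X 1 := by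
    intro t ht
    induction t, ht using Nat.le_induction with
    | base => exact fun _ => rfl
    | succ t ht ih => exact fun h => (hXinv t ht (by omega)).trans (ih (by omega))
  have hx : ∀ t, 1 ≤ t → t ≤ T + 1 → x t ∈ Xbig := by
    rintro (_ | _ | t) h₁ h₂
    · omega
    · exact hXsub 1 le_rfl h₂ hx1
    · exact hXsub _ h₁ h₂ (hproj (t + 1) (by omega) (by omega)).1
  have hvbig : ∀ t, 1 ≤ t → t ≤ T → v t ∈ Xbig := fun t h₁ h₂ =>
    hXsub t h₁ (by omega) (hv t h₁ h₂)
  have hproj' : ∀ t, 1 ≤ t → t ≤ T →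
      IsMetricProj (X t) (x t - η • gradient (f t) (x t)) (x (t + 1)) := fun t h₁ h₂ =>
    hXinv t h₁ h₂ ▸ hproj t h₁ h₂
  refine ⟨fun t h₁ h₂ => ?_, ?_⟩
  · rw [(hbar t h₁ h₂).unique (hXcv t h₁ (by omega)) (hproj' t h₁ h₂), sub_self, norm_zero]
  have hstep : ∀ t, 1 ≤ t → t ≤ T → f t (x t) - f t (v t) ≤
      η * G ^ 2 / 2 + (‖x t - v t‖ ^ 2 - ‖x (t + 1) - v t‖ ^ 2) / (2 * η) := fun t h₁ h₂ =>
    projected_gradient_step (hXcv t h₁ (by omega)) (hfcv t h₁ h₂) (hfd t h₁ h₂ _) hη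
      (hfg t h₁ h₂ _ (hx t h₁ (by omega))) (hproj' t h₁ h₂) (hv t h₁ h₂)
  have hsum : ∀ n, 1 ≤ n → n ≤ T →
      ∑ t ∈ Finset.Icc 1 n, f t (x t) - ∑ t ∈ Finset.Icc 1 n, f t (v t)
        ≤ η * n * G ^ 2 / 2 + (D ^ 2 - ‖x (n + 1) - v n‖ ^ 2) / (2 * η)
          + D * (∑ t ∈ Finset.Icc 2 n, ‖v (t - 1) - v t‖) / η := by
    intro n hn
    induction n, hn using Nat.le_induction with
    | base =>
      intro hT
      have hD : ‖x 1 - v 1‖ ^ 2 ≤ D ^ 2 := pow_le_pow_left₀ (norm_nonneg _)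
        (hdiam _ (hx 1 le_rfl (by omega)) _ (hvbig 1 le_rfl hT)) 2
      have hdiv : (‖x 1 - v 1‖ ^ 2 - ‖x (1 + 1) - v 1‖ ^ 2) / (2 * η)
          ≤ (D ^ 2 - ‖x (1 + 1) - v 1‖ ^ 2) / (2 * η) := by gcongr
      have h := hstep 1 le_rfl hT
      simp only [Finset.Icc_self, Finset.sum_singleton, Nat.cast_one, mul_one,
        Finset.Icc_eq_empty_of_lt one_lt_two, Finset.sum_empty, mul_zero, zero_div, add_zero]
      linarith
    | succ n hn ih =>
      intro hT
      have hpath := norm_sub_sq_sub_norm_sub_sq_le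
        (hdiam _ (hx (n + 1) (by omega) (by omega)) _ (hvbig n hn (by omega)))
        (hdiam _ (hx (n + 1) (by omega) (by omega)) _ (hvbig (n + 1) (by omega) hT))
      have hdiv : (‖x (n + 1) - v (n + 1)‖ ^ 2 - ‖x (n + 1) - v n‖ ^ 2) / (2 * η)
          ≤ 2 * D * ‖v n - v (n + 1)‖ / (2 * η) := by gcongr
      rw [mul_assoc, mul_div_mul_left _ _ two_ne_zero] at hdiv
      have h := hstep (n + 1) (by omega) hT
      have ih := ih (by omega)
      rw [Finset.sum_Icc_succ_top (by omega), Finset.sum_Icc_succ_top (by omega),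
        Finset.sum_Icc_succ_top (by omega), Nat.add_sub_cancel]
      push_cast
      simp only [sub_div, mul_add, add_mul, add_div] at *
      linarith
  have hD : 0 ≤ D := by simpa using hdiam 0 h0 0 h0
  rcases Nat.eq_zero_or_pos T with rfl | hT
  · simp only [Finset.Icc_eq_empty_of_lt zero_lt_one, Finset.Icc_eq_empty_of_lt zero_lt_two,
      Finset.sum_empty, Nat.cast_zero, mul_zero, zero_mul, zero_div, add_zero, sub_zero, zero_add]
    positivity
  · have hle : (D ^ 2 - ‖x (T + 1) - v T‖ ^ 2) / (2 * η) ≤ 7 * D ^ 2 / (4 * η) := by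
      rw [div_le_div_iff₀ (by positivity) (by positivity)]
      nlinarith [mul_nonneg hη.le (sq_nonneg D), mul_nonneg hη.le (sq_nonneg ‖x (T + 1) - v T‖)]
    linarith [hsum T hT le_rfl]
end
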